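/- arXiv:2411.11805 — 2 statements merged into one kernel-verified Lean document; each statement's English description precedes it below -/
import Mathlib

section
/- Let G be a finite group and let σ be a unitary representation of G of dimension D. Fix X ∈ Matrix (Fin D) (Fin D) ℂ and let vec X ∈ ℂ^{D·D} be its vectorization. Let τ = (1/√|G|) Σ_{k∈G} e_k ⊗ vec X ∈ ℂ^G ⊗ ℂ^{D·D}, and let U be the block-diagonal operator U = Σ_{k∈G} |k⟩⟨k| ⊗ (σ(k) ⊗ conj(σ(k))), where conj denotes entrywise complex conjugation and ⊗ on matrices is the Kronecker product. Then ⟨τ, U τ⟩ = tr(Xᴴ · E_σ(X)), where E_σ(X) = (1/|G|) Σ_{k∈G} σ(k) X σ(k)⁻¹. -/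
open Matrix Finset

/-- A (matrix) representation of a group `G`. -/
def IsRep {G : Type*} [Group G] {n : Type*} [Fintype n] [DecidableEq n]
    (σ : G → Matrix n n ℂ) : Prop :=
  σ 1 = 1 ∧ ∀ g h, σ g * σ h = σ (g * h)

/-- A representation is unitary if every image matrix is unitary. -/
def IsUnitaryRep {G : Type*} [Group G] {n : Type*} [Fintype n] [DecidableEq n]
    (σ : G → Matrix n n ℂ) : Prop :=
  ∀ g, σ g ∈ Matrix.unitaryGroup n ℂ

/-- Irreducibility: only invariant subspaces are `⊥` and `⊤`. -/
def IsIrreducibleRep {G : Type*} [Group G] {n : Type*} [Fintype n] [DecidableEq n]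
    (σ : G → Matrix n n ℂ) : Prop :=
  ∀ W : Submodule ℂ (n → ℂ), (∀ g, ∀ v ∈ W, (σ g).mulVec v ∈ W) → W = ⊥ ∨ W = ⊤

/-- Two representations are isomorphic: an invertible intertwiner `T ρ₁(g) = ρ₂(g) T`. -/
def RepIso {G : Type*} [Group G] {d₁ d₂ : ℕ}
    (ρ₁ : G → Matrix (Fin d₁) (Fin d₁) ℂ) (ρ₂ : G → Matrix (Fin d₂) (Fin d₂) ℂ) : Prop :=
  ∃ T : Matrix (Fin d₂) (Fin d₁) ℂ,
    (∃ S : Matrix (Fin d₁) (Fin d₂) ℂ, T * S = 1 ∧ S * T = 1) ∧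
    ∀ g, T * ρ₁ g = ρ₂ g * T

/-- Weak Fourier sampling operator `Ξ_ρ^{(σ)} = (d/|G|) ∑_g conj(χ_ρ(g)) σ(g)`. -/
noncomputable def wfs {G : Type*} [Group G] [Fintype G] {d D : ℕ}
    (ρ : G → Matrix (Fin d) (Fin d) ℂ) (σ : G → Matrix (Fin D) (Fin D) ℂ) :
    Matrix (Fin D) (Fin D) ℂ :=
  ((d : ℂ) / (Fintype.card G : ℂ)) • ∑ g : G, (starRingEnd ℂ) (ρ g).trace • σ g

/-- The quadratic form of `A ⊗ conj A` at `vec X` is `tr (Xᴴ A X Aᴴ)`. -/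
theorem sum_conj_vec_mul_kronecker_conj {n : Type*} [Fintype n] (A X : Matrix n n ℂ) :
    ∑ p : n × n, (starRingEnd ℂ) (X p.1 p.2) *
        ∑ q : n × n, A p.1 q.1 * (starRingEnd ℂ) (A p.2 q.2) * X q.1 q.2
      = (Xᴴ * (A * X * Aᴴ)).trace := by
  simp only [Matrix.trace, Matrix.diag, Matrix.mul_apply, Matrix.conjTranspose_apply,
    Fintype.sum_prod_type, starRingEnd_apply]
  rw [Finset.sum_comm]
  refine Finset.sum_congr rfl fun j _ => Finset.sum_congr rfl fun i _ => ?_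
  congr 1
  rw [Finset.sum_comm]
  refine Finset.sum_congr rfl fun b _ => ?_
  rw [Finset.sum_mul]
  exact Finset.sum_congr rfl fun a _ => by ring

theorem internal_state_test_expectation
    {G : Type*} [Group G] [Fintype G] [DecidableEq G] {D : ℕ}
    (σ : G → Matrix (Fin D) (Fin D) ℂ) (hσ : IsRep σ) (hσu : IsUnitaryRep σ)
    (X : Matrix (Fin D) (Fin D) ℂ) :
    let vecX : Fin D × Fin D → ℂ := fun p => X p.1 p.2
    let τ : G × (Fin D × Fin D) → ℂ :=
      fun q => (1 / ((Real.sqrt (Fintype.card G) : ℝ) : ℂ)) * vecX q.2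
    let U : Matrix (G × (Fin D × Fin D)) (G × (Fin D × Fin D)) ℂ :=
      fun q q' => (if q.1 = q'.1 then 1 else 0) *
        (σ q.1 q.2.1 q'.2.1 * (starRingEnd ℂ) (σ q.1 q.2.2 q'.2.2))
    (∑ q : G × (Fin D × Fin D), (starRingEnd ℂ) (τ q) * U.mulVec τ q)
      = (Xᴴ * ((1 / (Fintype.card G : ℂ)) • ∑ k : G, σ k * X * (σ k)⁻¹)).trace := by
  intro vecX τ U
  set c : ℂ := 1 / ((Real.sqrt (Fintype.card G) : ℝ) : ℂ) with hc
  have hcc : (starRingEnd ℂ) c * c = 1 / (Fintype.card G : ℂ) := by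
    have h : ((Real.sqrt (Fintype.card G) : ℝ) : ℂ) * ((Real.sqrt (Fintype.card G) : ℝ) : ℂ)
        = (Fintype.card G : ℂ) := by
      rw [← Complex.ofReal_mul, Real.mul_self_sqrt (Nat.cast_nonneg _), Complex.ofReal_natCast]
    rw [hc, map_div₀, map_one, Complex.conj_ofReal, div_mul_div_comm, one_mul, h]
  have hinv (k : G) : (σ k)⁻¹ = (σ k)ᴴ :=
    Matrix.inv_eq_right_inv (Matrix.mem_unitaryGroup_iff.mp (hσu k))
  have hU (k : G) (p : Fin D × Fin D) : U.mulVec τ (k, p) =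
      c * ∑ q : Fin D × Fin D,
        σ k p.1 q.1 * (starRingEnd ℂ) (σ k p.2 q.2) * X q.1 q.2 := by
    simp only [Matrix.mulVec, dotProduct, U, τ, vecX]
    rw [Fintype.sum_prod_type, Finset.sum_eq_single k]
    · rw [Finset.mul_sum]
      exact Finset.sum_congr rfl fun q _ => by rw [if_pos rfl]; ring
    · intro k' _ hk
      simp [hk.symm]
    · simp
  rw [Fintype.sum_prod_type, Matrix.mul_smul, Matrix.trace_smul, Matrix.mul_sum,
    Matrix.trace_sum, smul_eq_mul, Finset.mul_sum]
  refine Finset.sum_congr rfl fun k _ => ?_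
  rw [hinv, ← sum_conj_vec_mul_kronecker_conj, ← hcc, Finset.mul_sum]
  refine Finset.sum_congr rfl fun p _ => ?_
  rw [hU]
  simp only [τ, vecX, map_mul]
  ring
end

section
/- Let G be a finite group and let ρ^μ, ρ^ν, ρ^λ be irreducible unitary representations of G of dimensions d_μ, d_ν, d_λ. Let σ be the representation of dimension D = d_μ·d_ν defined by σ(g) = ρ^μ(g) ⊗ ρ^ν(g) (Kronecker product), and let Ξ_λ = (d_λ/|G|) Σ_{g∈G} conj(χ_λ(g)) σ(g) be the corresponding weak Fourier sampling operator. Let Φ⁺ = (1/√D) Σ_{i=1}^{D} e_i ⊗ e_i ∈ ℂ^D ⊗ ℂ^D be the maximally entangled state. Then ⟨Φ⁺, (Ξ_λ ⊗ I_D) Φ⁺⟩ = (d_λ/D) · (1/|G|) Σ_{g∈G} χ_μ(g) χ_ν(g) conj(χ_λ(g)); that is, the probability of measuring outcome λ under weak Fourier sampling of the first register of Φ⁺ equals (d_λ/(d_μ d_ν)) times the Kronecker-coefficient multiplicity ⟨χ_μ·χ_ν, χ_λ⟩. -/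
open Matrix Finset

open Kronecker in
/-- The expectation of `A ⊗ 1` in the state `c • ∑ i, e_i ⊗ e_i` is `|c|² tr A`. -/
theorem sum_conj_diagonal_mul_kronecker_one_mulVec {n : Type*} [Fintype n] [DecidableEq n]
    (A : Matrix n n ℂ) (c : ℂ) :
    ∑ p : n × n, (starRingEnd ℂ) (if p.1 = p.2 then c else 0) *
        ((A ⊗ₖ (1 : Matrix n n ℂ)).mulVec fun q => if q.1 = q.2 then c else 0) p
      = (starRingEnd ℂ) c * c * A.trace := by
  simp only [Matrix.mulVec, dotProduct, Fintype.sum_prod_type, Matrix.kroneckerMap_apply,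
    Matrix.one_apply, Matrix.trace, Matrix.diag_apply, apply_ite (starRingEnd ℂ), map_zero,
    ite_mul, zero_mul, mul_ite, mul_one, mul_zero, Finset.sum_ite_eq, Finset.mem_univ, if_true,
    Finset.mul_sum]
  exact Finset.sum_congr rfl fun i _ => by ring

open Kronecker in
theorem wfs_probability_on_maximally_entangled_state
    {G : Type*} [Group G] [Fintype G] {dmu dnu dlam : ℕ}
    (ρmu : G → Matrix (Fin dmu) (Fin dmu) ℂ) (ρnu : G → Matrix (Fin dnu) (Fin dnu) ℂ)
    (ρlam : G → Matrix (Fin dlam) (Fin dlam) ℂ)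
    (hμ : IsRep ρmu) (hμu : IsUnitaryRep ρmu) (hμirr : IsIrreducibleRep ρmu)
    (hν : IsRep ρnu) (hνu : IsUnitaryRep ρnu) (hνirr : IsIrreducibleRep ρnu)
    (hl : IsRep ρlam) (hlu : IsUnitaryRep ρlam) (hlirr : IsIrreducibleRep ρlam) :
    let σ : G → Matrix (Fin dmu × Fin dnu) (Fin dmu × Fin dnu) ℂ :=
      fun g => ρmu g ⊗ₖ ρnu g
    let Ξ : Matrix (Fin dmu × Fin dnu) (Fin dmu × Fin dnu) ℂ :=
      ((dlam : ℂ) / (Fintype.card G : ℂ)) • ∑ g : G, (starRingEnd ℂ) (ρlam g).trace • σ g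
    let Φ : (Fin dmu × Fin dnu) × (Fin dmu × Fin dnu) → ℂ :=
      fun p => if p.1 = p.2 then 1 / ((Real.sqrt (dmu * dnu) : ℝ) : ℂ) else 0
    ∑ p : (Fin dmu × Fin dnu) × (Fin dmu × Fin dnu),
        (starRingEnd ℂ) (Φ p) *
          ((Ξ ⊗ₖ (1 : Matrix (Fin dmu × Fin dnu) (Fin dmu × Fin dnu) ℂ)).mulVec Φ) p
      = ((dlam : ℂ) / ((dmu : ℂ) * (dnu : ℂ))) *
          ((1 / (Fintype.card G : ℂ)) *
            ∑ g : G, (ρmu g).trace * (ρnu g).trace * (starRingEnd ℂ) (ρlam g).trace) := by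
  intro σ Ξ Φ
  have hc : (starRingEnd ℂ) (1 / ((Real.sqrt (dmu * dnu) : ℝ) : ℂ)) *
      (1 / ((Real.sqrt (dmu * dnu) : ℝ) : ℂ)) = 1 / ((dmu : ℂ) * (dnu : ℂ)) := by
    rw [map_div₀, map_one, Complex.conj_ofReal, div_mul_div_comm, one_mul, ← Complex.ofReal_mul,
      Real.mul_self_sqrt (by positivity)]
    push_cast
    rfl
  have hΞ : Ξ.trace = ((dlam : ℂ) / (Fintype.card G : ℂ)) *
      ∑ g : G, (ρmu g).trace * (ρnu g).trace * (starRingEnd ℂ) (ρlam g).trace := by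
    simp only [Ξ, σ, Matrix.trace_smul, Matrix.trace_sum, Matrix.trace_kronecker, smul_eq_mul]
    exact congrArg _ (Finset.sum_congr rfl fun g _ => by ring)
  rw [sum_conj_diagonal_mul_kronecker_one_mulVec, hc, hΞ]
  ring
end
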